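/- For all integers $n\ge 1$ and $1\le k\le n$, $0 < 1 - \frac{\binom{n}{k}}{\binom{n+k}{k}} \le \frac{2k^2}{n}$. -/

import Mathlib

theorem Nat.choose_lt_choose_add {n k m : ℕ} (hk : 1 ≤ k) (hkn : k ≤ n) (hm : 1 ≤ m) :
    n.choose k < (n + m).choose k := by
  obtain ⟨j, rfl⟩ := Nat.exists_eq_add_of_le' hk
  calc n.choose (j + 1) < (n + 1).choose (j + 1) := by
        have := Nat.choose_pos (n := n) (k := j) (by omega)
        rw [Nat.choose_succ_succ']
        omega
    _ ≤ (n + m).choose (j + 1) := Nat.choose_le_choose _ (by omega)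

theorem Nat.sub_pow_mul_choose_add_le {n k : ℕ} (hkn : k ≤ n) :
    (n - k) ^ k * (n + k).choose k ≤ n ^ k * n.choose k := by
  refine Nat.le_of_mul_le_mul_left ?_ k.factorial_pos
  rw [mul_left_comm, mul_left_comm _ (n ^ k), ← Nat.descFactorial_eq_factorial_mul_choose,
    ← Nat.descFactorial_eq_factorial_mul_choose, Nat.descFactorial_eq_prod_range,
    Nat.descFactorial_eq_prod_range, Finset.pow_eq_prod_const, Finset.pow_eq_prod_const,
    ← Finset.prod_mul_distrib, ← Finset.prod_mul_distrib]
  refine Finset.prod_le_prod' fun i hi => ?_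
  have hik : i < k := Finset.mem_range.mp hi
  zify [hkn, hik.le.trans hkn, (by omega : i ≤ n + k)]
  have hik' : (i : ℤ) ≤ k := by exact_mod_cast hik.le
  nlinarith [mul_nonneg (Int.natCast_nonneg k) (sub_nonneg.mpr hik')]

/-- For `1 ≤ k ≤ n`, `0 < 1 - (n choose k)/((n+k) choose k) ≤ 2k²/n`. -/
theorem statement13 (n k : ℕ) (hn : 1 ≤ n) (hk1 : 1 ≤ k) (hkn : k ≤ n) :
    0 < 1 - (n.choose k : ℝ) / ((n + k).choose k : ℝ) ∧
      1 - (n.choose k : ℝ) / ((n + k).choose k : ℝ) ≤ 2 * (k : ℝ) ^ 2 / (n : ℝ) := by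
  have hn0 : (0 : ℝ) < n := by exact_mod_cast hn
  have hpos : (0 : ℝ) < (n + k).choose k := by exact_mod_cast Nat.choose_pos (by omega)
  constructor
  · rw [sub_pos, div_lt_one hpos]
    exact_mod_cast Nat.choose_lt_choose_add hk1 hkn hk1
  · have hratio : (1 + -((k : ℝ) / n)) ^ k ≤ (n.choose k : ℝ) / ((n + k).choose k : ℝ) := by
      have h : ((n : ℝ) - k) ^ k * (n + k).choose k ≤ (n : ℝ) ^ k * n.choose k := by
        have := Nat.sub_pow_mul_choose_add_le hkn
        rw [← Nat.cast_sub hkn]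
        exact_mod_cast this
      have heq : 1 + -((k : ℝ) / n) = (n - k) / n := by field_simp; ring
      rw [heq, div_pow, div_le_div_iff₀ (by positivity) hpos]
      linarith
    have hle : (k : ℝ) / n ≤ 1 := (div_le_one hn0).mpr (by exact_mod_cast hkn)
    have hbern := one_add_mul_le_pow (a := -((k : ℝ) / n)) (by linarith) k
    have hsq : 2 * (k : ℝ) ^ 2 / n = 2 * (k * (k / n)) := by ring
    have hnonneg : 0 ≤ (k : ℝ) * (k / n) := by positivity
    linarith
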